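/- Let α and β be standard Borel spaces, let μ and ν be probability measures on α, and let κ and η be Markov kernels from α to β. If KL(μ ⊗ₘ κ ‖ ν ⊗ₘ η) < ∞, then KL(μ ⊗ₘ κ ‖ ν ⊗ₘ η) = KL(μ ‖ ν) + ∫_α KL(κ(a) ‖ η(a)) dμ(a). -/

import Mathlib

open MeasureTheory ProbabilityTheory
open scoped ENNReal ProbabilityTheory

open Classical in
/-- The Kullback–Leibler divergence between two measures, defined as
`∫ log (dμ/dν) dμ` when `μ ≪ ν` (and this integral is well defined), and `∞` otherwise. -/
noncomputable def klDiv {α : Type*} [MeasurableSpace α] (μ ν : Measure α) : ℝ≥0∞ :=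
  if μ ≪ ν ∧ Integrable (llr μ ν) μ then ENNReal.ofReal (∫ x, llr μ ν x ∂μ) else ∞

/-- For probability measures, the log-likelihood-ratio definition agrees with
`InformationTheory.klDiv`. -/
lemma klDiv_eq_informationTheory_klDiv {α : Type*} [MeasurableSpace α] (μ ν : Measure α)
    [IsProbabilityMeasure μ] [IsProbabilityMeasure ν] :
    klDiv μ ν = InformationTheory.klDiv μ ν := by
  simp [klDiv, InformationTheory.klDiv_def]

section

variable {α β : Type*} [MeasurableSpace α] [MeasurableSpace β]
  [MeasurableSpace.CountableOrCountablyGenerated α β]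
  {μ : Measure α} [IsFiniteMeasure μ] {κ η : Kernel α β} [IsFiniteKernel κ] [IsFiniteKernel η]

/-- The density of `μ ⊗ₘ κ` with respect to `μ ⊗ₘ η` is the kernel density of `κ` with respect
to `η`. -/
lemma compProd_eq_withDensity_rnDeriv (h : μ ⊗ₘ κ ≪ μ ⊗ₘ η) :
    μ ⊗ₘ κ = (μ ⊗ₘ η).withDensity fun p ↦ Kernel.rnDeriv κ η p.1 p.2 := by
  ext s hs
  rw [withDensity_apply _ hs, ← lintegral_indicator hs,
    Measure.lintegral_compProd ((Kernel.measurable_rnDeriv κ η).indicator hs),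
    Measure.compProd_apply hs]
  refine lintegral_congr_ae ?_
  filter_upwards [h.kernel_of_compProd] with a ha
  have hs_a : MeasurableSet (Prod.mk a ⁻¹' s) := measurable_prodMk_left hs
  rw [← Kernel.setLIntegral_rnDeriv ha hs_a, ← lintegral_indicator hs_a]
  rfl

lemma rnDeriv_compProd_right (h : μ ⊗ₘ κ ≪ μ ⊗ₘ η) :
    (μ ⊗ₘ κ).rnDeriv (μ ⊗ₘ η) =ᵐ[μ ⊗ₘ η] fun p ↦ Kernel.rnDeriv κ η p.1 p.2 := by
  conv_lhs => rw [compProd_eq_withDensity_rnDeriv h]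
  exact Measure.rnDeriv_withDensity _ (Kernel.measurable_rnDeriv κ η)

lemma klDiv_compProd_right_eq_lintegral (h : μ ⊗ₘ κ ≪ μ ⊗ₘ η) :
    InformationTheory.klDiv (μ ⊗ₘ κ) (μ ⊗ₘ η)
      = ∫⁻ a, InformationTheory.klDiv (κ a) (η a) ∂μ := by
  have h_meas : Measurable fun p : α × β ↦
      ENNReal.ofReal (InformationTheory.klFun (Kernel.rnDeriv κ η p.1 p.2).toReal) :=
    (InformationTheory.measurable_klFun.comp
      (Kernel.measurable_rnDeriv κ η).ennreal_toReal).ennreal_ofReal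
  calc InformationTheory.klDiv (μ ⊗ₘ κ) (μ ⊗ₘ η)
  _ = ∫⁻ p, ENNReal.ofReal (InformationTheory.klFun (Kernel.rnDeriv κ η p.1 p.2).toReal)
      ∂(μ ⊗ₘ η) := by
    rw [InformationTheory.klDiv_eq_lintegral_klFun_of_ac h]
    refine lintegral_congr_ae ?_
    filter_upwards [rnDeriv_compProd_right h] with p hp
    rw [hp]
  _ = ∫⁻ a, ∫⁻ b, ENNReal.ofReal (InformationTheory.klFun (Kernel.rnDeriv κ η a b).toReal)
      ∂(η a) ∂μ := Measure.lintegral_compProd h_meas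
  _ = ∫⁻ a, InformationTheory.klDiv (κ a) (η a) ∂μ := by
    refine lintegral_congr_ae ?_
    filter_upwards [h.kernel_of_compProd] with a ha
    rw [InformationTheory.klDiv_eq_lintegral_klFun_of_ac ha]
    refine lintegral_congr_ae ?_
    filter_upwards [Kernel.rnDeriv_eq_rnDeriv_measure (κ := κ) (η := η) (a := a)] with b hb
    rw [hb]

end

/-- Chain rule for the Kullback–Leibler divergence of composition-product measures:
if `KL(μ ⊗ₘ κ ‖ ν ⊗ₘ η) < ∞` then it equals `KL(μ ‖ ν) + ∫ KL(κ a ‖ η a) dμ(a)`. -/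
theorem klDiv_compProd_eq_add {α β : Type*}
    [MeasurableSpace α] [StandardBorelSpace α]
    [MeasurableSpace β] [StandardBorelSpace β]
    (μ ν : Measure α) [IsProbabilityMeasure μ] [IsProbabilityMeasure ν]
    (κ η : Kernel α β) [IsMarkovKernel κ] [IsMarkovKernel η]
    (hfin : klDiv (μ ⊗ₘ κ) (ν ⊗ₘ η) ≠ ∞) :
    klDiv (μ ⊗ₘ κ) (ν ⊗ₘ η) = klDiv μ ν + ∫⁻ a, klDiv (κ a) (η a) ∂μ := by
  have h_ac : μ ⊗ₘ κ ≪ μ ⊗ₘ η := by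
    have h : μ ⊗ₘ κ ≪ ν ⊗ₘ η := by
      by_contra h
      exact hfin (if_neg fun hc ↦ h hc.1)
    exact (Measure.absolutelyContinuous_compProd_iff.mp h).2
  simp_rw [klDiv_eq_informationTheory_klDiv]
  rw [InformationTheory.klDiv_compProd_eq_add, klDiv_compProd_right_eq_lintegral h_ac]
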